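/- If G is a one-ended, quasi-transitive graph, then its unique end is thick, i.e. has infinite vertex degree. -/

import Mathlib

open Set Cardinal

namespace PaperEnds

/-- A ray in `G`: a one-sided infinite path, i.e. an injective sequence of
pairwise adjacent consecutive vertices. -/
def IsRay {V : Type} (G : SimpleGraph V) (r : ℕ → V) : Prop :=
  Function.Injective r ∧ ∀ n, G.Adj (r n) (r (n + 1))

/-- `a` and `b` are connected by a walk avoiding the vertex set `S`. -/
def ReachableOutside {V : Type} (G : SimpleGraph V) (S : Set V) (a b : V) : Prop :=
  ∃ w : G.Walk a b, ∀ v ∈ w.support, v ∉ S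

/-- Two rays are equivalent (belong to the same end) if for every finite vertex
set `S` they have tails lying in the same component of `G − S`. -/
def RayEquiv {V : Type} (G : SimpleGraph V) (r₁ r₂ : ℕ → V) : Prop :=
  ∀ S : Set V, S.Finite → ∃ m n : ℕ,
    (∀ i, m ≤ i → r₁ i ∉ S) ∧ (∀ j, n ≤ j → r₂ j ∉ S) ∧
    ReachableOutside G S (r₁ m) (r₂ n)

/-- `r` is a ray belonging to the end represented by the ray `ω`. -/
def InEnd {V : Type} (G : SimpleGraph V) (ω r : ℕ → V) : Prop :=
  IsRay G r ∧ RayEquiv G r ω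

/-- `G` has exactly one end: it has a ray and any two rays are equivalent. -/
def OneEnded {V : Type} (G : SimpleGraph V) : Prop :=
  (∃ r, IsRay G r) ∧ ∀ r₁ r₂, IsRay G r₁ → IsRay G r₂ → RayEquiv G r₁ r₂

/-- A family of pairwise (vertex-)disjoint rays. -/
def DisjointRays {V : Type} {ι : Type} (f : ι → ℕ → V) : Prop :=
  Pairwise fun i j => Disjoint (Set.range (f i)) (Set.range (f j))

/-- The end represented by `ω` has vertex degree `k`: the maximum cardinality of a
family of pairwise disjoint rays belonging to the end is `k`. -/
def EndVertexDegree {V : Type} (G : SimpleGraph V) (ω : ℕ → V) (k : ℕ) : Prop :=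
  (∃ f : Fin k → ℕ → V, (∀ i, InEnd G ω (f i)) ∧ DisjointRays f) ∧
  ¬ ∃ f : Fin (k + 1) → ℕ → V, (∀ i, InEnd G ω (f i)) ∧ DisjointRays f

/-- `v` dominates the end represented by `ω`: for every ray `r` in the end there are
infinitely many `v`–`r` paths pairwise meeting only in `v`. -/
def Dominates {V : Type} (G : SimpleGraph V) (v : V) (ω : ℕ → V) : Prop :=
  ∀ r : ℕ → V, InEnd G ω r →
    ∃ (t : ℕ → ℕ) (P : (n : ℕ) → G.Walk v (r (t n))),
      Function.Injective t ∧
      (∀ n, (P n).IsPath) ∧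
      (∀ n, ∀ u ∈ (P n).support, u ∈ Set.range r → u = r (t n)) ∧
      (∀ m n, m ≠ n → ∀ u, u ∈ (P m).support → u ∈ (P n).support → u = v)

/-- The end represented by `ω` is undominated. -/
def Undominated {V : Type} (G : SimpleGraph V) (ω : ℕ → V) : Prop :=
  ¬ ∃ v, Dominates G v ω

/-- `(A, B)` is a separation of `G`. -/
def IsSeparation {V : Type} (G : SimpleGraph V) (A B : Set V) : Prop :=
  A ∪ B = Set.univ ∧ ∀ a ∈ A \ B, ∀ b ∈ B \ A, ¬ G.Adj a b

/-- The order of a separation `(A, B)`, i.e. `|A ∩ B|` as an extended natural number. -/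
noncomputable def SepOrder {V : Type} (A B : Set V) : ℕ∞ := (A ∩ B).encard

/-- The end represented by `ω` lies in the side `B`: every ray of the end has all
but finitely many vertices in `B`. -/
def LiesIn {V : Type} (G : SimpleGraph V) (ω : ℕ → V) (B : Set V) : Prop :=
  ∀ r, InEnd G ω r → ∃ m, ∀ n, m ≤ n → r n ∈ B

/-- The vertex set `s` is connected in `G` (any two of its vertices are joined by a
walk inside `s`). -/
def ConnectedIn {V : Type} (G : SimpleGraph V) (s : Set V) : Prop :=
  ∀ a ∈ s, ∀ b ∈ s, ∃ w : G.Walk a b, ∀ v ∈ w.support, v ∈ s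

/-- `(A, B)` is an ω-relevant separation (for the end of vertex degree `k`
represented by the ray `ω`). -/
def Relevant {V : Type} (G : SimpleGraph V) (ω : ℕ → V) (k : ℕ) (A B : Set V) : Prop :=
  IsSeparation G A B ∧ SepOrder A B = (k : ℕ∞) ∧
  ConnectedIn G (A \ B) ∧
  (∀ v ∈ A ∩ B, ∃ u ∈ A \ B, G.Adj v u) ∧
  LiesIn G ω B ∧
  ¬ ∃ C D : Set V, IsSeparation G C D ∧ SepOrder C D < (k : ℕ∞) ∧ A ⊆ C ∧ LiesIn G ω D

/-- Two separations `(A, B)` and `(C, D)` are nested. -/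
def Nested {V : Type} (A B C D : Set V) : Prop :=
  (A ⊆ C ∧ D ⊆ B) ∨ (A ⊆ D ∧ C ⊆ B) ∨ (B ⊆ C ∧ D ⊆ A) ∨ (B ⊆ D ∧ C ⊆ A)

/-! ### Reachability outside a set -/

section Reach

variable {V : Type} {G : SimpleGraph V}

theorem RO_refl {S : Set V} {a : V} (h : a ∉ S) : ReachableOutside G S a a :=
  ⟨SimpleGraph.Walk.nil, by simpa using h⟩

theorem RO_symm {S : Set V} {a b : V} (h : ReachableOutside G S a b) :
    ReachableOutside G S b a := by
  obtain ⟨w, hw⟩ := h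
  exact ⟨w.reverse, by simpa using hw⟩

theorem RO_trans {S : Set V} {a b c : V} (h : ReachableOutside G S a b)
    (h' : ReachableOutside G S b c) : ReachableOutside G S a c := by
  obtain ⟨w, hw⟩ := h
  obtain ⟨w', hw'⟩ := h'
  refine ⟨w.append w', fun v hv => ?_⟩
  rw [SimpleGraph.Walk.mem_support_append_iff] at hv
  rcases hv with hv | hv
  · exact hw v hv
  · exact hw' v hv

theorem RO_mono {S T : Set V} {a b : V} (hST : S ⊆ T) (h : ReachableOutside G T a b) :
    ReachableOutside G S a b := by
  obtain ⟨w, hw⟩ := h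
  exact ⟨w, fun v hv hS => hw v hv (hST hS)⟩

theorem RO_left {S : Set V} {a b : V} (h : ReachableOutside G S a b) : a ∉ S := by
  obtain ⟨w, hw⟩ := h
  exact hw a w.start_mem_support

theorem RO_right {S : Set V} {a b : V} (h : ReachableOutside G S a b) : b ∉ S :=
  RO_left (RO_symm h)

theorem RO_step {S : Set V} {a b c : V} (hab : G.Adj a b) (ha : a ∉ S)
    (h : ReachableOutside G S b c) : ReachableOutside G S a c := by
  obtain ⟨w, hw⟩ := h
  refine ⟨SimpleGraph.Walk.cons hab w, fun v hv => ?_⟩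
  rw [SimpleGraph.Walk.support_cons, List.mem_cons] at hv
  rcases hv with rfl | hv
  · exact ha
  · exact hw v hv

theorem RO_hit {S : Set V} {a b : V} (T : Set V) (h : ReachableOutside G S a b) :
    ReachableOutside G (S ∪ T) a b ∨
      ∃ t ∈ T, ReachableOutside G S a t ∧ ReachableOutside G S t b := by
  obtain ⟨w, hw⟩ := h
  induction w with
  | nil =>
    rename_i u
    have hu : u ∉ S := hw u (by simp)
    by_cases hT : u ∈ T
    · exact Or.inr ⟨u, hT, RO_refl hu, RO_refl hu⟩
    · exact Or.inl (RO_refl (by simp [hu, hT]))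
  | cons hadj p ih =>
    rename_i u v w
    have hu : u ∉ S := hw u (by simp)
    have hp : ∀ x ∈ p.support, x ∉ S := fun x hx => hw x (by simp [hx])
    by_cases hT : u ∈ T
    · exact Or.inr ⟨u, hT, RO_refl hu, RO_step hadj hu ⟨p, hp⟩⟩
    · rcases ih hp with h | ⟨t, ht, h1, h2⟩
      · exact Or.inl (RO_step hadj (by simp [hu, hT]) h)
      · exact Or.inr ⟨t, ht, RO_step hadj hu h1, h2⟩

theorem RO_last {S : Set V} {a b : V} (X : Set V) (hb : b ∉ X)
    (h : ReachableOutside G S a b) :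
    ReachableOutside G (S ∪ X) a b ∨
      ∃ x ∈ X, ∃ c, G.Adj x c ∧ ReachableOutside G S a x ∧
        ReachableOutside G (S ∪ X) c b := by
  obtain ⟨w, hw⟩ := h
  induction w with
  | nil =>
    rename_i u
    have hu : u ∉ S := hw u (by simp)
    exact Or.inl (RO_refl (by simp [hu, hb]))
  | cons hadj p ih =>
    rename_i u v w
    have hu : u ∉ S := hw u (by simp)
    have hp : ∀ x ∈ p.support, x ∉ S := fun x hx => hw x (by simp [hx])
    rcases ih hb hp with h | ⟨x, hx, c, h1, h2, h3⟩
    · by_cases hT : u ∈ X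
      · exact Or.inr ⟨u, hT, v, hadj, RO_refl hu, h⟩
      · exact Or.inl (RO_step hadj (by simp [hu, hT]) h)
    · exact Or.inr ⟨x, hx, c, h1, RO_step hadj hu h2, h3⟩

/-- vertices of a walk are reachable from its start. -/
theorem RO_of_mem {S : Set V} {a b : V} (w : G.Walk a b) (hw : ∀ v ∈ w.support, v ∉ S)
    {v : V} (hv : v ∈ w.support) : ReachableOutside G S v b := by
  classical
  refine ⟨w.dropUntil v hv, fun x hx => hw x ?_⟩
  exact (w.support_dropUntil_subset_support hv) hx

theorem RO_map {S : Set V} {a b : V} (g : G ≃g G) (h : ReachableOutside G S a b) :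
    ReachableOutside G (g '' S) (g a) (g b) := by
  obtain ⟨w, hw⟩ := h
  refine ⟨w.map g.toHom, fun v hv => ?_⟩
  rw [SimpleGraph.Walk.support_map, List.mem_map] at hv
  obtain ⟨x, hx, rfl⟩ := hv
  rintro ⟨y, hy, hyx⟩
  have : y = x := g.injective hyx
  exact hw x hx (this ▸ hy)

/-- The side of the separator `S` in which the ray `r` has a tail. -/
def Side (G : SimpleGraph V) (r : ℕ → V) (S : Set V) (v : V) : Prop :=
  ∃ n, ∀ m, n ≤ m → ReachableOutside G S v (r m)

variable {r : ℕ → V}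

theorem Side_notMem {S : Set V} {v : V} (h : Side G r S v) : v ∉ S := by
  obtain ⟨n, hn⟩ := h
  exact RO_left (hn n le_rfl)

theorem Side_anti {S T : Set V} {v : V} (hST : S ⊆ T) (h : Side G r T v) : Side G r S v := by
  obtain ⟨n, hn⟩ := h
  exact ⟨n, fun m hm => RO_mono hST (hn m hm)⟩

theorem Side_of_RO {S : Set V} {u v : V} (h : ReachableOutside G S u v) (hv : Side G r S v) :
    Side G r S u := by
  obtain ⟨n, hn⟩ := hv
  exact ⟨n, fun m hm => RO_trans h (hn m hm)⟩

theorem Side_step {S : Set V} {u v : V} (h : G.Adj u v) (hu : u ∉ S) (hv : Side G r S v) :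
    Side G r S u :=
  Side_of_RO (RO_step h hu (RO_refl (Side_notMem hv))) hv

theorem Side_RO {S : Set V} {u v : V} (hu : Side G r S u) (hv : Side G r S v) :
    ReachableOutside G S u v := by
  obtain ⟨n, hn⟩ := hu
  obtain ⟨n', hn'⟩ := hv
  exact RO_trans (hn (max n n') (le_max_left _ _)) (RO_symm (hn' _ (le_max_right _ _)))

theorem RO_tail (hr : ∀ n, G.Adj (r n) (r (n + 1))) {S : Set V} {n : ℕ}
    (hn : ∀ m, n ≤ m → r m ∉ S) : ∀ m, n ≤ m → ReachableOutside G S (r n) (r m) := by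
  intro m hm
  induction m, hm using Nat.le_induction with
  | base => exact RO_refl (hn n le_rfl)
  | succ m hm ih =>
    exact RO_trans ih (RO_step (hr m) (hn m hm) (RO_refl (hn _ (by omega))))

theorem Side_of_RO_tail (hr : IsRay G r) {S : Set V} {v : V} {n : ℕ}
    (hn : ∀ m, n ≤ m → r m ∉ S) (h : ReachableOutside G S v (r n)) : Side G r S v :=
  ⟨n, fun m hm => RO_trans h (RO_tail hr.2 hn m hm)⟩

theorem ray_avoid (hr : IsRay G r) {S : Set V} (hS : S.Finite) :
    ∃ n, ∀ m, n ≤ m → r m ∉ S := by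
  have h1 : (r ⁻¹' S).Finite := hS.preimage hr.1.injOn
  obtain ⟨n, hn⟩ := h1.bddAbove
  refine ⟨n + 1, fun m hm h => ?_⟩
  have : m ≤ n := hn h
  omega

theorem Side_tail (hr : IsRay G r) {S : Set V} (hS : S.Finite) :
    ∃ n, ∀ m, n ≤ m → Side G r S (r m) := by
  obtain ⟨n, hn⟩ := ray_avoid hr hS
  refine ⟨n, fun m hm => Side_of_RO_tail hr (n := m) (fun j hj => hn j (hm.trans hj)) ?_⟩
  exact RO_refl (hn m hm)

theorem Side_avoid {S T : Set V} {b : V} (hb : Side G r S b) (hT : ∀ t ∈ T, ¬ Side G r S t) :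
    Side G r (S ∪ T) b := by
  obtain ⟨n, hn⟩ := id hb
  refine ⟨n, fun m hm => ?_⟩
  rcases RO_hit T (hn m hm) with h | ⟨t, ht, h1, h2⟩
  · exact h
  · exact absurd (Side_of_RO (RO_symm h1) hb) (hT t ht)

theorem sep_trans {S S' : Set V} {x : V} (hx : ¬ Side G r S x)
    (hS : ∀ s ∈ S, ¬ Side G r S' s) : ¬ Side G r S' x :=
  fun h => hx (Side_anti subset_union_right (Side_avoid h hS))

theorem Side_last (hr : IsRay G r) {Q X : Set V} (hQ : Q.Finite) (hX : X.Finite) {y : V}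
    (hy : Side G r Q y) :
    Side G r (Q ∪ X) y ∨ ∃ x ∈ X, ∃ c, G.Adj x c ∧ ReachableOutside G Q y x ∧
      Side G r (Q ∪ X) c := by
  obtain ⟨n, hn⟩ := hy
  obtain ⟨n', hn'⟩ := Side_tail hr (hQ.union hX)
  have h1 := hn' (max n n') (le_max_right _ _)
  have h2 := hn (max n n') (le_max_left _ _)
  have h3 : r (max n n') ∉ X := fun h => Side_notMem h1 (Or.inr h)
  rcases RO_last X h3 h2 with h | ⟨x, hx, c, hc, h4, h5⟩
  · exact Or.inl (Side_of_RO h h1)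
  · exact Or.inr ⟨x, hx, c, hc, h4, Side_of_RO h5 h1⟩

theorem Side_equiv {r₁ r₂ : ℕ → V} (h1 : IsRay G r₁) (h2 : IsRay G r₂)
    (h : RayEquiv G r₁ r₂) {S : Set V} (hS : S.Finite) {v : V} (hv : Side G r₁ S v) :
    Side G r₂ S v := by
  obtain ⟨m, n, hm, hn, hmn⟩ := h S hS
  have h3 : Side G r₁ S (r₁ m) := Side_of_RO_tail h1 hm (RO_refl (hm m le_rfl))
  exact Side_of_RO_tail h2 hn (RO_trans (Side_RO hv h3) hmn)

theorem isRay_map (g : G ≃g G) (hr : IsRay G r) : IsRay G (fun n => g (r n)) :=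
  ⟨g.injective.comp hr.1, fun n => g.map_adj_iff.mpr (hr.2 n)⟩

theorem Side_map (hone : OneEnded G) (hr : IsRay G r) (g : G ≃g G) {S : Set V} (hS : S.Finite)
    {v : V} (hv : Side G r S v) : Side G r (g '' S) (g v) := by
  have h1 : Side G (fun n => g (r n)) (g '' S) (g v) := by
    obtain ⟨n, hn⟩ := hv
    exact ⟨n, fun m hm => RO_map g (hn m hm)⟩
  exact Side_equiv (isRay_map g hr) hr (hone.2 _ _ (isRay_map g hr) hr) (hS.image _) h1

theorem image_inv (g : G ≃g G) (S : Set V) : (g⁻¹ : G ≃g G) '' (g '' S) = S := by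
  rw [← Set.image_comp]
  have : (⇑(g⁻¹ : G ≃g G) ∘ ⇑g) = id := by
    funext x
    exact g.symm_apply_apply x
  rw [this, Set.image_id]

theorem Side_map_iff (hone : OneEnded G) (hr : IsRay G r) (g : G ≃g G) {S : Set V}
    (hS : S.Finite) {v : V} : Side G r (g '' S) (g v) ↔ Side G r S v := by
  refine ⟨fun h => ?_, Side_map hone hr g hS⟩
  have := Side_map hone hr (g⁻¹ : G ≃g G) (hS.image _) h
  rw [image_inv] at this
  have h2 : (g⁻¹ : G ≃g G) (g v) = v := g.symm_apply_apply v
  rwa [h2] at this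

end Reach

/-! ### Finite families of finite sets -/

section Hyper

open Classical in
theorem finite_subfamily {V : Type} (m : ℕ) : ∀ (E : Set (Finset V)),
    (∀ T : Finset V, T.card < m → ∃ e ∈ E, Disjoint e T) →
    ∃ E' : Set (Finset V), E'.Finite ∧ E' ⊆ E ∧
      ∀ T : Finset V, T.card < m → ∃ e ∈ E', Disjoint e T := by
  induction m with
  | zero => exact fun E _ => ⟨∅, Set.finite_empty, Set.empty_subset _, fun T hT => by omega⟩
  | succ m ih =>
    intro E hE
    obtain ⟨e, he, -⟩ := hE ∅ (by simp)
    have h1 : ∀ v : V, ∃ E' : Set (Finset V), E'.Finite ∧ E' ⊆ {e ∈ E | v ∉ e} ∧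
      ∀ T : Finset V, T.card < m → ∃ e ∈ E', Disjoint e T := by
      intro v
      apply ih
      intro T hT
      obtain ⟨f, hf, hd⟩ := hE (insert v T) (by have := Finset.card_insert_le v T; omega)
      rw [Finset.disjoint_insert_right] at hd
      exact ⟨f, ⟨hf, hd.1⟩, hd.2⟩
    choose F hF1 hF2 hF3 using h1
    refine ⟨insert e (⋃ v ∈ e, F v), ?_, ?_, ?_⟩
    · exact (e.finite_toSet.biUnion (fun v _ => hF1 v)).insert e
    · intro f hf
      rcases hf with rfl | hf
      · exact he
      · simp only [Set.mem_iUnion] at hf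
        obtain ⟨v, hv, hf⟩ := hf
        exact (hF2 v hf).1
    · intro T hT
      by_cases hd : Disjoint e T
      · exact ⟨e, Set.mem_insert _ _, hd⟩
      · rw [Finset.not_disjoint_iff] at hd
        obtain ⟨v, hv, hvT⟩ := hd
        obtain ⟨f, hf, hfd⟩ := hF3 v (T.erase v)
          (by have := Finset.card_erase_lt_of_mem hvT; omega)
        refine ⟨f, Set.mem_insert_of_mem _ (Set.mem_biUnion hv hf), ?_⟩
        have hvf := (hF2 v hf).2
        rw [Finset.disjoint_left] at hfd ⊢
        intro a ha haT
        refine hfd ha (Finset.mem_erase.mpr ⟨?_, haT⟩)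
        rintro rfl
        exact hvf ha

open Classical in
theorem finite_min_hitting {V : Type} (m : ℕ) : ∀ (E : Set (Finset V)),
    {S : Finset V | S.card ≤ m ∧ (∀ e ∈ E, ¬ Disjoint e S) ∧
      ∀ s ∈ S, ∃ e ∈ E, Disjoint e (S.erase s)}.Finite := by
  induction m with
  | zero =>
    intro E
    refine (Set.finite_singleton (∅ : Finset V)).subset ?_
    rintro S ⟨h, -⟩
    simpa using h
  | succ m ih =>
    intro E
    by_cases hE : ∃ e, e ∈ E
    · obtain ⟨e, he⟩ := hE
      refine (e.finite_toSet.biUnion (fun v _ => (ih {f ∈ E | v ∉ f}).image (insert v))).subset ?_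
      rintro S ⟨h1, h2, h3⟩
      have := h2 e he
      rw [Finset.not_disjoint_iff] at this
      obtain ⟨v, hv, hvS⟩ := this
      refine Set.mem_biUnion hv ⟨S.erase v, ⟨?_, ?_, ?_⟩, Finset.insert_erase hvS⟩
      · have := Finset.card_erase_lt_of_mem hvS; omega
      · rintro f ⟨hf, hvf⟩ hd
        refine h2 f hf ?_
        rw [Finset.disjoint_left] at hd ⊢
        intro a ha haS
        refine hd ha (Finset.mem_erase.mpr ⟨?_, haS⟩)
        rintro rfl
        exact hvf ha
      · intro s hs
        rw [Finset.mem_erase] at hs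
        obtain ⟨f, hf, hd⟩ := h3 s hs.2
        refine ⟨f, ⟨hf, ?_⟩, ?_⟩
        · intro hvf
          exact Finset.disjoint_left.mp hd hvf (Finset.mem_erase.mpr ⟨hs.1.symm, hvS⟩)
        · exact Finset.disjoint_of_subset_right (Finset.erase_subset_erase _ (Finset.erase_subset _ _)) hd
    · refine (Set.finite_singleton (∅ : Finset V)).subset ?_
      rintro S ⟨-, -, h3⟩
      rw [Set.mem_singleton_iff, Finset.eq_empty_iff_forall_notMem]
      intro s hs
      obtain ⟨e, he, -⟩ := h3 s hs
      exact hE ⟨e, he⟩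

open Classical in
theorem finite_layer {V : Type} {G : SimpleGraph V} (S S' : Finset V) (m : ℕ) (P : V → Prop)
    (h : ∀ T : Finset V, T.card < m → ∃ s ∈ S, ∃ s' ∈ S', ∃ w : G.Walk s s',
      ∀ v ∈ w.support, v ∉ T ∧ P v) :
    ∃ F : Finset V, (∀ v ∈ F, P v) ∧ ∀ T : Finset V, T.card < m →
      ∃ s ∈ S, ∃ s' ∈ S', ∃ w : G.Walk s s', ∀ v ∈ w.support, v ∉ T ∧ v ∈ F := by
  obtain ⟨E, hE1, hE2, hE3⟩ := finite_subfamily m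
    {e : Finset V | ∃ s ∈ S, ∃ s' ∈ S', ∃ w : G.Walk s s', w.support.toFinset = e ∧
      ∀ v ∈ w.support, P v} (by
      intro T hT
      obtain ⟨s, hs, s', hs', w, hw⟩ := h T hT
      refine ⟨w.support.toFinset, ⟨s, hs, s', hs', w, rfl, fun v hv => (hw v hv).2⟩, ?_⟩
      rw [Finset.disjoint_left]
      intro a ha
      exact (hw a (by simpa using ha)).1)
  refine ⟨hE1.toFinset.biUnion id, ?_, ?_⟩
  · intro v hv
    simp only [Finset.mem_biUnion, Set.Finite.mem_toFinset, id] at hv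
    obtain ⟨e, he, hv⟩ := hv
    obtain ⟨s, hs, s', hs', w, rfl, hw⟩ := hE2 he
    exact hw v (by simpa using hv)
  · intro T hT
    obtain ⟨e, he, hd⟩ := hE3 T hT
    obtain ⟨s, hs, s', hs', w, hwe, hw⟩ := hE2 he
    refine ⟨s, hs, s', hs', w, fun v hv => ?_⟩
    have hve : v ∈ e := by rw [← hwe]; simpa using hv
    refine ⟨Finset.disjoint_left.mp hd hve, ?_⟩
    simp only [Finset.mem_biUnion, Set.Finite.mem_toFinset, id]
    exact ⟨e, he, hve⟩

end Hyper

/-! ### Building disjoint rays -/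

section Rays

theorem rays_of_injection {V : Type} {G : SimpleGraph V} (X : Finset V) (σ : V → V)
    (hσ : Function.Injective σ) (hadj : ∀ v, σ v = v ∨ G.Adj v (σ v))
    (hX : ∀ v, σ v ∉ X) :
    ∃ f : X → ℕ → V, (∀ i, IsRay G (f i)) ∧ DisjointRays f := by
  have key : ∀ (x y : X) (a b : ℕ), σ^[a] x = σ^[b] y → a = b ∧ x = y := by
    have aux : ∀ (x y : X) (a b : ℕ), a ≤ b → σ^[a] x = σ^[b] y → a = b ∧ x = y := by
      intro x y a b hab h
      obtain ⟨c, rfl⟩ := Nat.exists_eq_add_of_le hab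
      rw [Function.iterate_add_apply] at h
      have h2 := hσ.iterate a h
      cases c with
      | zero => exact ⟨rfl, Subtype.ext h2⟩
      | succ c =>
        rw [Function.iterate_succ_apply'] at h2
        exact absurd x.2 (h2 ▸ hX _)
    intro x y a b h
    rcases le_total a b with hab | hab
    · exact aux x y a b hab h
    · obtain ⟨h1, h2⟩ := aux y x b a hab h.symm
      exact ⟨h1.symm, h2.symm⟩
  refine ⟨fun x n => σ^[n] x, fun x => ⟨fun a b h => (key x x a b h).1, fun n => ?_⟩, ?_⟩
  · rcases hadj (σ^[n] x) with h | h
    · rw [← Function.iterate_succ_apply' σ n (x : V)] at h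
      have := (key x x _ _ h).1
      omega
    · simpa only [Function.iterate_succ_apply'] using h
  · intro x y hxy
    rw [Set.disjoint_left]
    rintro _ ⟨a, rfl⟩ ⟨b, hb⟩
    exact hxy (key x y a b hb.symm).2

set_option maxHeartbeats 1000000 in
open Classical in
theorem rays_of_layers {V : Type} {G : SimpleGraph V} (U S : ℕ → Finset V)
    (hdis : ∀ n, Disjoint (U n) (S n)) (hU : ∀ n, U n ⊆ U (n + 1)) (hS : ∀ n, S n ⊆ U (n + 1))
    (hw : ∀ n, ∀ T : Finset V, T.card < (S n).card → ∃ s ∈ S n, ∃ s' ∈ S (n + 1),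
      ∃ w : G.Walk s s', ∀ v ∈ w.support, v ∉ T ∧ v ∈ U (n + 1) ∪ S (n + 1) ∧ v ∉ U n) :
    ∃ f : S 0 → ℕ → V, (∀ i, IsRay G (f i)) ∧ DisjointRays f := by
  have hmono : Monotone U := monotone_nat_of_le_succ hU
  let rk : V → ℕ := fun v => sInf {n | v ∈ U (n + 1)}
  have hrk : ∀ v n, v ∈ U (n + 1) → v ∉ U n → rk v = n := by
    intro v n h1 h2
    apply le_antisymm
    · exact Nat.sInf_le h1
    · by_contra hlt
      push Not at hlt
      have h3 : v ∈ U (rk v + 1) := Nat.sInf_mem (s := {n | v ∈ U (n + 1)}) ⟨n, h1⟩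
      exact h2 (hmono hlt h3)
  let t : V → Finset V := fun v =>
    insert v ((U (rk v + 1) ∪ S (rk v + 1)).filter (fun w => G.Adj v w))
  have hall : ∀ W : Finset V, W.card ≤ (W.biUnion (fun v => t v \ S 0)).card := by
    intro W
    set N : Finset V := W.biUnion t with hN
    have hWN : W ⊆ N := fun v hv => Finset.mem_biUnion.mpr ⟨v, hv, Finset.mem_insert_self _ _⟩
    have hNX : W.biUnion (fun v => t v \ S 0) = N \ S 0 := by
      ext v
      simp only [hN, Finset.mem_biUnion, Finset.mem_sdiff]
      tauto
    rw [hNX]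
    have step : ∀ n, (S n ∩ W).card ≤
        ((N \ W) ∩ ((U (n + 1) ∪ S (n + 1)) \ (U n ∪ S n))).card + (S (n + 1) ∩ W).card := by
      intro n
      by_contra hlt
      push Not at hlt
      set T : Finset V := (S n \ W) ∪ (((N \ W) ∩ ((U (n + 1) ∪ S (n + 1)) \ (U n ∪ S n))) ∪
        (S (n + 1) ∩ W)) with hT
      have hcard : T.card < (S n).card := by
        have h1 : T.card ≤ _ := Finset.card_union_le _ _
        have h2 := Finset.card_union_le
          ((N \ W) ∩ ((U (n + 1) ∪ S (n + 1)) \ (U n ∪ S n))) (S (n + 1) ∩ W)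
        have h3 := Finset.card_sdiff_add_card_inter (S n) W
        omega
      obtain ⟨s, hs, s', hs', w, hw⟩ := hw n T hcard
      have claim : ∀ (a b : V) (w : G.Walk a b), b ∈ S (n + 1) → a ∈ W → a ∉ S (n + 1) →
          (∀ v ∈ w.support, v ∉ T ∧ v ∈ U (n + 1) ∪ S (n + 1) ∧ v ∉ U n) → False := by
        intro a b w
        induction w with
        | nil => exact fun h1 _ h2 _ => h2 h1
        | cons hadj p ih =>
          rename_i a b c
          intro hc ha haS hsup
          have hb := hsup b (by simp)
          have ha' := hsup a (by simp)
          have haU : a ∈ U (n + 1) := by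
            rcases Finset.mem_union.mp ha'.2.1 with h | h
            · exact h
            · exact absurd h haS
          have hbN : b ∈ N := by
            refine Finset.mem_biUnion.mpr ⟨a, ha, Finset.mem_insert_of_mem ?_⟩
            rw [Finset.mem_filter, hrk a n haU ha'.2.2]
            exact ⟨hb.2.1, hadj⟩
          have hbT := hb.1
          have hb1 := hb.2.1
          have hb2 := hb.2.2
          simp only [hT, Finset.mem_union, Finset.mem_sdiff, Finset.mem_inter] at hbT hb1
          have hbW : b ∈ W := by by_contra hbW; by_cases hbSn : b ∈ S n <;> simp_all
          have hbS : b ∉ S (n + 1) := fun h => hbT (Or.inr (Or.inr ⟨h, hbW⟩))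
          exact ih hc hbW hbS (fun v hv => hsup v (by simp [hv]))
      have hsT := (hw s (by simp)).1
      have hsW : s ∈ W := by
        by_contra h
        exact hsT (by simp [hT, hs, h])
      have hsS : s ∉ S (n + 1) := fun h =>
        Finset.disjoint_left.mp (hdis (n + 1)) (hS n hs) h
      exact claim s s' w hs' hsW hsS hw
    have tot : ∀ n, (S 0 ∩ W).card ≤
        (((N \ W) \ S 0) ∩ (U n ∪ S n)).card + (S n ∩ W).card := by
      intro n
      induction n with
      | zero => omega
      | succ n ih =>
        have h1 := step n
        have h2 : (((N \ W) \ S 0) ∩ (U n ∪ S n)).card +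
          ((N \ W) ∩ ((U (n + 1) ∪ S (n + 1)) \ (U n ∪ S n))).card ≤
            (((N \ W) \ S 0) ∩ (U (n + 1) ∪ S (n + 1))).card := by
          rw [← Finset.card_union_of_disjoint]
          · apply Finset.card_le_card
            intro v hv
            have hS0 : v ∈ S 0 → v ∈ U n ∪ S n := by
              intro hv0
              rcases Nat.eq_zero_or_pos n with rfl | hn
              · exact Finset.mem_union_right _ hv0
              · exact Finset.mem_union_left _ (hmono (show 0 + 1 ≤ n by omega) (hS 0 hv0))
            have ha := @hU n v
            have hb := @hS n v
            simp only [Finset.mem_union, Finset.mem_sdiff, Finset.mem_inter] at hv hS0 ⊢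
            clear_value N; grind
          · rw [Finset.disjoint_left]
            intro v hv
            simp only [Finset.mem_union, Finset.mem_sdiff, Finset.mem_inter] at hv ⊢
            clear_value N; grind
        omega
    have hev : ∃ n, S n ∩ W = ∅ := by
      by_contra hne
      push Not at hne
      choose q hq using fun n => hne n
      have hqi : Function.Injective (fun n => (⟨q n, (Finset.mem_inter.mp (hq n)).2⟩ : W)) := by
        have aux : ∀ a b, a < b → q a ≠ q b := by
          intro a b hab h
          have h1 : q a ∈ U b := hmono hab (hS a (Finset.mem_inter.mp (hq a)).1)
          rw [h] at h1
          exact Finset.disjoint_left.mp (hdis b) h1 (Finset.mem_inter.mp (hq b)).1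
        intro a b h
        have h' : q a = q b := congrArg Subtype.val h
        rcases lt_trichotomy a b with hl | hl | hl
        · exact absurd h' (aux a b hl)
        · exact hl
        · exact absurd h'.symm (aux b a hl)
      exact not_injective_infinite_finite _ hqi
    obtain ⟨n, hn⟩ := hev
    have h1 := tot n
    rw [hn, Finset.card_empty] at h1
    have h2 : (((N \ W) \ S 0) ∩ (U n ∪ S n)).card ≤ ((N \ W) \ S 0).card :=
      Finset.card_le_card Finset.inter_subset_left
    have h3 : (N \ S 0).card = (W \ S 0).card + ((N \ W) \ S 0).card := by
      rw [← Finset.card_union_of_disjoint]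
      · congr 1
        ext v
        have := @hWN v
        simp only [Finset.mem_union, Finset.mem_sdiff]
        clear_value N; grind
      · rw [Finset.disjoint_left]
        intro v hv
        simp only [Finset.mem_sdiff] at hv ⊢
        clear_value N; grind
    have h4 := Finset.card_sdiff_add_card_inter W (S 0)
    rw [Finset.inter_comm] at h4
    omega
  obtain ⟨σ, hσ, hσt⟩ := (Finset.all_card_le_biUnion_card_iff_exists_injective _).mp hall
  refine rays_of_injection (S 0) σ hσ ?_ ?_
  · intro v
    have := (Finset.mem_sdiff.mp (hσt v)).1
    rcases Finset.mem_insert.mp this with h | h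
    · exact Or.inl h
    · exact Or.inr (Finset.mem_filter.mp h).2
  · intro v
    exact (Finset.mem_sdiff.mp (hσt v)).2

theorem rays_of_good {V : Type} [DecidableEq V] {G : SimpleGraph V}
    (Good : Finset V → Finset V → Prop)
    (hdis : ∀ U S, Good U S → Disjoint U S)
    (hstep : ∀ U S, Good U S → ∃ U' S', Good U' S' ∧ U ⊆ U' ∧ S ⊆ U' ∧
      ∀ T : Finset V, T.card < S.card → ∃ s ∈ S, ∃ s' ∈ S',
      ∃ w : G.Walk s s', ∀ v ∈ w.support, v ∉ T ∧ v ∈ U' ∪ S' ∧ v ∉ U)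
    (U S : Finset V) (h0 : Good U S) (k : ℕ) (hk : k ≤ S.card) :
    ∃ f : Fin k → ℕ → V, (∀ i, IsRay G (f i)) ∧ DisjointRays f := by
  classical
  have h1 : ∀ p : {p : Finset V × Finset V // Good p.1 p.2},
      ∃ q : {p : Finset V × Finset V // Good p.1 p.2}, p.1.1 ⊆ q.1.1 ∧ p.1.2 ⊆ q.1.1 ∧
      ∀ T : Finset V, T.card < p.1.2.card → ∃ s ∈ p.1.2, ∃ s' ∈ q.1.2,
      ∃ w : G.Walk s s', ∀ v ∈ w.support, v ∉ T ∧ v ∈ q.1.1 ∪ q.1.2 ∧ v ∉ p.1.1 := by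
    rintro ⟨⟨U, S⟩, h⟩
    obtain ⟨U', S', h1, h2, h3, h4⟩ := hstep U S h
    exact ⟨⟨⟨U', S'⟩, h1⟩, h2, h3, h4⟩
  choose nx hnx1 hnx2 hnx3 using h1
  let sq : ℕ → {p : Finset V × Finset V // Good p.1 p.2} :=
    fun n => Nat.rec ⟨⟨U, S⟩, h0⟩ (fun _ p => nx p) n
  obtain ⟨f, hf1, hf2⟩ := rays_of_layers (G := G) (fun n => (sq n).1.1) (fun n => (sq n).1.2)
    (fun n => hdis _ _ (sq n).2) (fun n => hnx1 (sq n)) (fun n => hnx2 (sq n))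
    (fun n => by convert hnx3 (sq n))
  have hc : k ≤ Fintype.card (S : Finset V) := by simpa using hk
  obtain ⟨e⟩ : Nonempty (Fin k ↪ (S : Finset V)) :=
    Function.Embedding.nonempty_of_card_le (by simpa using hk)
  refine ⟨fun i => f (e i), fun i => hf1 _, fun i j hij => hf2 (fun h => hij (e.injective h))⟩

end Rays

/-! ### Separators -/

section Sep

variable {V : Type} {G : SimpleGraph V} {r : ℕ → V}

/-- Every vertex can be separated from the end of `r` by a finite set. -/
def Undom (G : SimpleGraph V) (r : ℕ → V) : Prop :=
  ∀ v : V, ∃ S : Finset V, v ∉ S ∧ ¬ Side G r S v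

open Classical in
theorem sep_disjoint (hr : IsRay G r) (hu : Undom G r) (X : Finset V) :
    ∃ Q : Finset V, Disjoint X Q ∧ ∀ x ∈ X, ¬ Side G r Q x := by
  choose q hq1 hq2 using hu
  refine ⟨X.biUnion q \ X, Finset.disjoint_sdiff, fun y hy h => ?_⟩
  rcases Side_last hr (Finset.finite_toSet _) X.finite_toSet h with h1 | ⟨x, hx, c, hc, -, h1⟩
  · exact Side_notMem h1 (Or.inr hy)
  · have hsub : (q x : Set V) ⊆ ↑(X.biUnion q \ X) ∪ ↑X := by
      intro v hv
      by_cases hvX : v ∈ X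
      · exact Or.inr hvX
      · left
        simp only [Finset.coe_sdiff, Set.mem_sdiff, Finset.mem_coe, Finset.mem_biUnion]
        exact ⟨⟨x, hx, hv⟩, hvX⟩
    exact hq2 x (Side_step hc (by simpa using hq1 x) (Side_anti hsub h1))

theorem exists_min_card (P : Finset V → Prop) (h : ∃ S, P S) :
    ∃ S, P S ∧ ∀ S', P S' → S.card ≤ S'.card := by
  obtain ⟨S, hS, hmin⟩ := (measure (Finset.card (α := V))).wf.has_min {S | P S} h
  exact ⟨S, hS, fun S' hS' => not_lt.mp (hmin S' hS')⟩

open Classical in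
theorem next_sep (hr : IsRay G r) (hu : Undom G r) (X : Finset V) :
    ∃ S : Finset V, Disjoint X S ∧ (∀ x ∈ X, ¬ Side G r S x) ∧
      ∀ S' : Finset V, (∀ s ∈ S, ¬ Side G r S' s) → S.card ≤ S'.card := by
  obtain ⟨Q, hXQ, hQ⟩ := sep_disjoint hr hu X
  obtain ⟨S, hS, hmin⟩ := exists_min_card (fun S : Finset V => ∀ q ∈ Q, ¬ Side G r S q)
    ⟨Q, fun q hq h => Side_notMem h hq⟩
  refine ⟨S, ?_, fun x hx => sep_trans (hQ x hx) hS, fun S' hS' => hmin S' fun q hq =>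
    sep_trans (hS q hq) hS'⟩
  have h1 : ∀ q ∈ Q, ¬ Side G r ↑(S \ X) q := by
    intro q hq h
    rcases Side_last hr (Finset.finite_toSet _) Q.finite_toSet h with h1 | ⟨x, hx, c, hc, h2, h1⟩
    · exact Side_notMem h1 (Or.inr hq)
    · have h3 := Side_avoid (T := (X : Set V)) h1
        (fun t ht h => hQ t ht (Side_anti subset_union_right h))
      have hsub : (S : Set V) ⊆ ↑(S \ X) ∪ ↑Q ∪ ↑X := by
        intro v hv
        by_cases hvX : v ∈ X
        · exact Or.inr hvX
        · left; left
          simp only [Finset.coe_sdiff, Set.mem_sdiff, Finset.mem_coe]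
          exact ⟨hv, hvX⟩
      have hxS : x ∉ (S : Set V) := by
        intro hxS
        refine RO_right h2 ?_
        simp only [Finset.coe_sdiff, Set.mem_sdiff, Finset.mem_coe]
        exact ⟨hxS, fun h => Finset.disjoint_left.mp hXQ h hx⟩
      exact hS x hx (Side_step hc hxS (Side_anti hsub h3))
  have h2 := hmin _ h1
  have h3 : S \ X = S := Finset.eq_of_subset_of_card_le Finset.sdiff_subset h2
  rw [← h3]
  exact Finset.disjoint_sdiff

open Classical in
theorem rays_undom (hr : IsRay G r) (hu : Undom G r) (k : ℕ) (S : Finset V)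
    (hS : ∀ S' : Finset V, (∀ s ∈ S, ¬ Side G r S' s) → S.card ≤ S'.card) (hk : k ≤ S.card) :
    ∃ f : Fin k → ℕ → V, (∀ i, IsRay G (f i)) ∧ DisjointRays f := by
  refine rays_of_good (fun U S => Disjoint U S ∧ (∀ u ∈ U, ¬ Side G r S u) ∧
    ∀ S' : Finset V, (∀ s ∈ S, ¬ Side G r S' s) → S.card ≤ S'.card) (fun U S h => h.1) ?_
    ∅ S ⟨Finset.disjoint_empty_left _, by simp, hS⟩ k hk
  clear hk hS S
  rintro U S ⟨hdis, hUS, hmin⟩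
  obtain ⟨S', hd', hsep', hmin'⟩ := next_sep hr hu (U ∪ S)
  rw [Finset.disjoint_union_left] at hd'
  obtain ⟨F, hF, hFw⟩ := finite_layer (G := G) S S' S.card
    (fun v => v ∉ U ∧ (v ∈ S' ∨ ¬ Side G r S' v)) (by
    intro T hT
    have h1 : ∃ s ∈ S, Side G r T s := by
      by_contra hne
      push Not at hne
      have := hmin T hne
      omega
    obtain ⟨s, hs, hsT⟩ := h1
    rcases Side_last hr (Finset.finite_toSet _) S.finite_toSet hsT with h1 | ⟨x, hx, c, hc, h2, h1⟩
    · exact (Side_notMem h1 (Or.inr hs)).elim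
    have h3 := Side_avoid (T := (U : Set V)) h1
        (fun t ht h => hUS t ht (Side_anti subset_union_right h))
    have hxU : x ∉ U := fun h => Finset.disjoint_left.mp hdis h hx
    have hxT : x ∉ T := RO_right h2
    have h4 : Side G r (↑T ∪ ↑U) x := by
      refine Side_step hc (by simp [hxT, hxU]) (Side_anti ?_ h3)
      intro v hv
      rcases hv with hv | hv
      · exact Or.inl (Or.inl hv)
      · exact Or.inr hv
    have hxS' : x ∉ S' := Finset.disjoint_left.mp hd'.2 hx
    have hxs : ¬ Side G r S' x := hsep' x (Finset.mem_union_right _ hx)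
    obtain ⟨n, hn⟩ := h4
    obtain ⟨n', hn'⟩ := Side_tail hr S'.finite_toSet
    have h5 := RO_symm (hn (max n n') (le_max_left _ _))
    have h6 := hn' (max n n') (le_max_right _ _)
    rcases RO_last (S' : Set V) (by simpa using hxS') h5 with h7 | ⟨s', hs', c', hc', h7, h8⟩
    · exact absurd (Side_of_RO (RO_symm (RO_mono subset_union_right h7)) h6) hxs
    · obtain ⟨w, hw⟩ := h8
      refine ⟨x, hx, s', hs', (SimpleGraph.Walk.cons hc' w).reverse, ?_⟩
      intro v hv
      rw [SimpleGraph.Walk.support_reverse, List.mem_reverse, SimpleGraph.Walk.support_cons,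
        List.mem_cons] at hv
      rcases hv with rfl | hv
      · have := RO_right h7
        simp only [Set.mem_union, Finset.mem_coe, not_or] at this
        exact ⟨this.1, this.2, Or.inl hs'⟩
      · have h9 := hw v hv
        simp only [Set.mem_union, Finset.mem_coe, not_or] at h9
        refine ⟨h9.1.1, h9.1.2, Or.inr fun h => hxs ?_⟩
        have h10 := RO_of_mem w hw hv
        exact Side_of_RO (RO_symm (RO_mono subset_union_right h10)) h)
  refine ⟨(U ∪ S ∪ F) \ S', S', ⟨Finset.sdiff_disjoint, ?_, hmin'⟩, ?_, ?_, ?_⟩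
  · intro u hu
    simp only [Finset.mem_sdiff, Finset.mem_union] at hu
    obtain ⟨hu | hu, hu'⟩ := hu
    · exact hsep' u (Finset.mem_union.mpr hu)
    · rcases (hF u hu).2 with h | h
      · exact absurd h hu'
      · exact h
  · intro v hv
    have := Finset.disjoint_left.mp hd'.1 hv
    simp [hv, this]
  · intro v hv
    have := Finset.disjoint_left.mp hd'.2 hv
    simp [hv, this]
  · intro T hT
    obtain ⟨s, hs, s', hs', w, hw⟩ := hFw T hT
    refine ⟨s, hs, s', hs', w, fun v hv => ⟨(hw v hv).1, ?_, (hF v (hw v hv).2).1⟩⟩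
    have := (hw v hv).2
    by_cases h : v ∈ S' <;> simp [h, this]

theorem bounded_sep (hr : IsRay G r) (hu : Undom G r) (k : ℕ)
    (hk : ¬ ∃ f : Fin (k + 1) → ℕ → V, (∀ i, IsRay G (f i)) ∧ DisjointRays f) (X : Finset V) :
    ∃ S : Finset V, Disjoint X S ∧ (∀ x ∈ X, ¬ Side G r S x) ∧ S.card ≤ k := by
  obtain ⟨S, h1, h2, h3⟩ := next_sep hr hu X
  refine ⟨S, h1, h2, ?_⟩
  by_contra hlt
  exact hk (rays_undom hr hu (k + 1) S h3 (by omega))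

open Classical in
theorem rays_dom (k : ℕ)
    (hD : {v | ∀ S : Finset V, v ∉ S → Side G r S v}.Infinite) :
    ∃ f : Fin k → ℕ → V, (∀ i, IsRay G (f i)) ∧ DisjointRays f := by
  have hex : ∀ X : Finset V, ∃ S : Finset V, Disjoint X S ∧ S.card = k ∧
      ∀ v ∈ S, ∀ S : Finset V, v ∉ S → Side G r S v := by
    intro X
    obtain ⟨S, hS1, hS2⟩ := (hD.sdiff X.finite_toSet).exists_subset_card_eq k
    refine ⟨S, ?_, hS2, fun v hv => (hS1 hv).1⟩
    rw [Finset.disjoint_right]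
    exact fun v hv => (hS1 hv).2
  obtain ⟨S, -, hS1, hS2⟩ := hex ∅
  refine rays_of_good (fun U S => Disjoint U S ∧ S.card = k ∧
    ∀ v ∈ S, ∀ S : Finset V, v ∉ S → Side G r S v) (fun U S h => h.1) ?_
    ∅ S ⟨Finset.disjoint_empty_left _, hS1, hS2⟩ k hS1.ge
  clear hS1 hS2 S
  rintro U S ⟨hdis, hSk, hSd⟩
  obtain ⟨S', hd', hSk', hSd'⟩ := hex (U ∪ S)
  rw [Finset.disjoint_union_left] at hd'
  obtain ⟨F, hF, hFw⟩ := finite_layer (G := G) S S' S.card (fun v => v ∉ U) (by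
    intro T hT
    obtain ⟨s, hs, hsT⟩ := Finset.exists_mem_notMem_of_card_lt_card hT
    obtain ⟨s', hs', hsT'⟩ := Finset.exists_mem_notMem_of_card_lt_card
      (show T.card < S'.card by omega)
    have h1 := hSd s hs (T ∪ U) (by simp [hsT, Finset.disjoint_right.mp hdis hs])
    have h2 := hSd' s' hs' (T ∪ U) (by simp [hsT', Finset.disjoint_right.mp hd'.1 hs'])
    obtain ⟨w, hw⟩ := Side_RO h1 h2
    refine ⟨s, hs, s', hs', w, fun v hv => ?_⟩
    simpa using hw v hv)
  refine ⟨(U ∪ S ∪ F) \ S', S', ⟨Finset.sdiff_disjoint, hSk', hSd'⟩, ?_, ?_, ?_⟩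
  · intro v hv
    have := Finset.disjoint_left.mp hd'.1 hv
    simp [hv, this]
  · intro v hv
    have := Finset.disjoint_left.mp hd'.2 hv
    simp [hv, this]
  · intro T hT
    obtain ⟨s, hs, s', hs', w, hw⟩ := hFw T hT
    refine ⟨s, hs, s', hs', w, fun v hv => ⟨(hw v hv).1, ?_, hF v (hw v hv).2⟩⟩
    have := (hw v hv).2
    by_cases h : v ∈ S' <;> simp [h, this]

/-- Tight separators. -/
def Tight (G : SimpleGraph V) (r : ℕ → V) (k : ℕ) (S : Finset V) (a : V) : Prop :=
  S.card ≤ k ∧ a ∉ S ∧ ¬ Side G r S a ∧ (∃ v ∈ S, G.Adj v a) ∧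
    ∀ v ∈ S, ∃ x b, G.Adj v x ∧ ReachableOutside G S a x ∧ G.Adj v b ∧ Side G r S b

open Classical in
theorem exists_conn (o : V) (Y : Finset V) (hY : ∀ y ∈ Y, ReachableOutside G ∅ y o) :
    ∃ X : Finset V, Y ⊆ X ∧ o ∈ X ∧
      ∀ x ∈ X, ∀ S : Finset V, Disjoint X S → ReachableOutside G S x o := by
  have h1 : ∀ y : Y, ∃ w : G.Walk y o, True := fun y => by
    obtain ⟨w, -⟩ := hY y y.2
    exact ⟨w, trivial⟩
  choose w hw using h1
  refine ⟨insert o (Finset.univ.biUnion fun y => (w y).support.toFinset), ?_,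
    Finset.mem_insert_self _ _, ?_⟩
  · intro y hy
    refine Finset.mem_insert_of_mem (Finset.mem_biUnion.mpr ⟨⟨y, hy⟩, Finset.mem_univ _, ?_⟩)
    simp
  · intro x hx S hS
    rw [Finset.disjoint_left] at hS
    rcases Finset.mem_insert.mp hx with rfl | hx
    · exact RO_refl (by simpa using hS (Finset.mem_insert_self _ _))
    · obtain ⟨y, -, hy⟩ := Finset.mem_biUnion.mp hx
      refine RO_of_mem (w y) (fun v hv => ?_) (by simpa using hy)
      simpa using hS (Finset.mem_insert_of_mem
        (Finset.mem_biUnion.mpr ⟨y, Finset.mem_univ _, by simpa using hv⟩))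

open Classical in
theorem tight_exists (hr : IsRay G r) (hu : Undom G r) (k : ℕ)
    (hk : ¬ ∃ f : Fin (k + 1) → ℕ → V, (∀ i, IsRay G (f i)) ∧ DisjointRays f) (Y : Finset V) :
    ∃ (S : Finset V) (a : V), Tight G r k S a ∧ Disjoint Y S ∧ ∀ y ∈ Y, ¬ Side G r S y := by
  have ho : Side G r ∅ (r 0) :=
    Side_of_RO_tail hr (n := 0) (by simp) (RO_refl (by simp))
  obtain ⟨X, hYX, hoX, hX⟩ := exists_conn (G := G) (r 0) (Y.filter (fun y => Side G r ∅ y))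
    (fun y hy => Side_RO (Finset.mem_filter.mp hy).2 ho)
  obtain ⟨S, ⟨h1, h2, h3⟩, hmin⟩ := exists_min_card (fun S : Finset V => Disjoint X S ∧
    (∀ x ∈ X, ¬ Side G r S x) ∧ S.card ≤ k) (bounded_sep hr hu k hk X)
  have hcoe : ∀ v ∈ S, (↑(S.erase v) ∪ {v} : Set V) = ↑S := by
    intro v hv
    ext x
    simp only [Finset.coe_erase, Set.mem_union, Set.mem_sdiff, Set.mem_singleton_iff,
      Finset.mem_coe]
    by_cases hx : x = v
    · simp [hx, hv]
    · simp [hx]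
  have key : ∀ v ∈ S, ∃ x b, G.Adj v x ∧ ReachableOutside G S x (r 0) ∧ G.Adj v b ∧
      Side G r S b := by
    intro v hv
    have hlt := Finset.card_erase_lt_of_mem hv
    have h4 : ∃ x ∈ X, Side G r ↑(S.erase v) x := by
      by_contra hne
      push Not at hne
      have := hmin (S.erase v) ⟨Finset.disjoint_of_subset_right (Finset.erase_subset _ _) h1,
        hne, by omega⟩
      omega
    obtain ⟨x, hx, hxs⟩ := h4
    have hxS : x ∉ S := Finset.disjoint_left.mp h1 hx
    rcases Side_last hr (Finset.finite_toSet _) (Set.finite_singleton v) hxs with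
      h5 | ⟨v', hv', b, hb, h6, h5⟩
    · rw [hcoe v hv] at h5
      exact absurd h5 (h2 x hx)
    · rw [hcoe v hv] at h5
      rw [Set.mem_singleton_iff] at hv'
      subst hv'
      have hxv : x ∉ ({v'} : Set V) := by
        rintro rfl
        exact hxS hv
      rcases RO_last {v'} hxv (RO_symm h6) with h7 | ⟨v'', hv'', a, ha, -, h7⟩
      · rw [hcoe v' hv] at h7
        exact absurd hv (RO_left h7)
      · rw [hcoe v' hv] at h7
        rw [Set.mem_singleton_iff] at hv''
        subst hv''
        exact ⟨a, b, ha, RO_trans h7 (hX x hx S h1), hb, h5⟩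
  have hne : S.Nonempty := by
    rw [Finset.nonempty_iff_ne_empty]
    rintro rfl
    exact h2 _ hoX (by simpa using ho)
  obtain ⟨v0, hv0⟩ := hne
  obtain ⟨a, b, ha, hao, hb, hbS⟩ := key v0 hv0
  refine ⟨S, a, ⟨h3, RO_left hao, fun h => h2 _ hoX (Side_of_RO (RO_symm hao) h),
    ⟨v0, hv0, ha⟩, ?_⟩, ?_, ?_⟩
  · intro v hv
    obtain ⟨x, b, h4, h5, h6, h7⟩ := key v hv
    exact ⟨x, b, h4, RO_trans hao (RO_symm h5), h6, h7⟩
  · rw [Finset.disjoint_right]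
    intro v hv hvY
    obtain ⟨x, b, h4, h5, h6, h7⟩ := key v hv
    have h8 : Side G r ∅ v := Side_step h6 (by simp) (Side_anti (Set.empty_subset _) h7)
    exact Finset.disjoint_left.mp h1 (hYX (Finset.mem_filter.mpr ⟨hvY, h8⟩)) hv
  · intro y hy h
    have h8 : Side G r ∅ y := Side_anti (Set.empty_subset _) h
    exact h2 y (hYX (Finset.mem_filter.mpr ⟨hy, h8⟩)) h

open Classical in
theorem finite_tight (hr : IsRay G r) (hu : Undom G r) (k : ℕ) (u : V) :
    {S : Finset V | Tight G r k S u}.Finite := by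
  obtain ⟨T, hT1, hT2⟩ := sep_disjoint hr hu {u}
  obtain ⟨T', hT1', hT2'⟩ := sep_disjoint hr hu T
  have huT : u ∉ T := by simpa using hT1
  have huT2 : ¬ Side G r T u := hT2 u (by simp)
  refine ((T ∪ T').finite_toSet.biUnion (fun t _ => finite_min_hitting k
    {e : Finset V | ∃ w : G.Walk u t, w.support.toFinset = e})).subset ?_
  rintro S ⟨h1, h2, h3, ⟨v, hv, hvu⟩, h5⟩
  have ht : ∃ t ∈ T ∪ T', Side G r S t := by
    by_contra hne
    push Not at hne
    obtain ⟨x, b, -, -, hb, hbS⟩ := h5 v hv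
    have hb1 : Side G r T b := Side_anti subset_union_right (Side_avoid hbS
      (fun t ht => hne t (Finset.mem_union_left _ ht)))
    have hb2 : Side G r T' b := Side_anti subset_union_right (Side_avoid hbS
      (fun t ht => hne t (Finset.mem_union_right _ ht)))
    by_cases hvT : v ∈ T
    · exact hT2' v hvT (Side_step hb (Finset.disjoint_left.mp hT1' hvT) hb2)
    · exact huT2 (Side_step hvu.symm huT (Side_step hb hvT hb1))
  obtain ⟨t, ht, htS⟩ := ht
  refine Set.mem_biUnion (show t ∈ ((T ∪ T' : Finset V) : Set V) from ht) ⟨h1, ?_, ?_⟩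
  · rintro e ⟨w, rfl⟩ hd
    refine h3 (Side_of_RO ⟨w, fun v hv => ?_⟩ htS)
    exact Finset.disjoint_left.mp hd (by simpa using hv)
  · intro v hv
    obtain ⟨x, b, hx, hux, hb, hbS⟩ := h5 v hv
    have hsub : (↑(S.erase v) : Set V) ⊆ ↑S := by simp
    have hvS : v ∉ (↑(S.erase v) : Set V) := by simp
    have h6 : ReachableOutside G ↑(S.erase v) v t :=
      RO_step hb hvS (RO_mono hsub (Side_RO hbS htS))
    have h7 := RO_mono hsub hux
    obtain ⟨w, hw⟩ := RO_trans h7 (RO_step hx.symm (RO_right h7) h6)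
    refine ⟨w.support.toFinset, ⟨w, rfl⟩, ?_⟩
    rw [Finset.disjoint_left]
    intro y hy
    exact fun h => hw y (by simpa using hy) (Finset.mem_coe.mpr h)

open Classical in
theorem Tight_map (hone : OneEnded G) (hr : IsRay G r) (g : G ≃g G) {k : ℕ} {S : Finset V} {a : V}
    (h : Tight G r k S a) : Tight G r k (S.image g) (g a) := by
  obtain ⟨h1, h2, h3, ⟨v, hv, hva⟩, h5⟩ := h
  refine ⟨Finset.card_image_le.trans h1, ?_, ?_, ⟨g v, Finset.mem_image_of_mem _ hv,
    g.map_adj_iff.mpr hva⟩, ?_⟩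
  · rw [Finset.mem_image]
    rintro ⟨x, hx, hxa⟩
    exact h2 (g.injective hxa ▸ hx)
  · rw [Finset.coe_image, Side_map_iff hone hr g S.finite_toSet]
    exact h3
  · intro w hw
    obtain ⟨v, hv, rfl⟩ := Finset.mem_image.mp hw
    obtain ⟨x, b, hx, hax, hb, hbS⟩ := h5 v hv
    refine ⟨g x, g b, g.map_adj_iff.mpr hx, ?_, g.map_adj_iff.mpr hb, ?_⟩
    · rw [Finset.coe_image]
      exact RO_map g hax
    · rw [Finset.coe_image]
      exact Side_map hone hr g S.finite_toSet hbS

open Classical in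
theorem exists_translation (hone : OneEnded G) (hr : IsRay G r) (hu : Undom G r)
    (hqt : ∃ s : Finset V, ∀ v : V, ∃ u ∈ s, ∃ φ : G ≃g G, φ u = v) (k : ℕ)
    (hk : ¬ ∃ f : Fin (k + 1) → ℕ → V, (∀ i, IsRay G (f i)) ∧ DisjointRays f) :
    ∃ (S : Finset V) (a : V) (h : G ≃g G), Tight G r k S a ∧
      (∀ s ∈ S, s ∉ h '' (S : Set V)) ∧ ∀ s ∈ S, ¬ Side G r (h '' (S : Set V)) s := by
  obtain ⟨R, hR⟩ := hqt
  choose F A hF1 hF2 hF3 using tight_exists hr hu k hk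
  choose rep hrep g hg using hR
  let Y : ℕ → Finset V := fun n => Nat.rec ∅ (fun _ Z => Z ∪ F Z) n
  have hY : ∀ n, Y (n + 1) = Y n ∪ F (Y n) := fun n => rfl
  have hYm : Monotone Y := monotone_nat_of_le_succ fun n => by
    rw [hY]; exact Finset.subset_union_left
  have hfin : (⋃ u ∈ R, {S : Finset V | Tight G r k S u}).Finite :=
    R.finite_toSet.biUnion (fun u _ => finite_tight hr hu k u)
  have hinv : ∀ v, (g v)⁻¹ v = rep v := by
    intro v
    have : (g v)⁻¹ (g v (rep v)) = rep v := (g v).symm_apply_apply _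
    rwa [hg] at this
  let B : ℕ → Finset V := fun n => (F (Y n)).image ((g (A (Y n)))⁻¹ : G ≃g G)
  have hB : ∀ n, B n ∈ ⋃ u ∈ R, {S : Finset V | Tight G r k S u} := by
    intro n
    refine Set.mem_biUnion (hrep (A (Y n))) ?_
    have := Tight_map hone hr ((g (A (Y n)))⁻¹ : G ≃g G) (hF1 (Y n))
    rwa [hinv] at this
  have : ∃ i j, i < j ∧ B i = B j := by
    have := hfin.to_subtype
    obtain ⟨i, j, hij, h⟩ := Finite.exists_ne_map_eq_of_infinite
      (fun n => (⟨B n, hB n⟩ : ↥(⋃ u ∈ R, {S : Finset V | Tight G r k S u})))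
    have h' : B i = B j := congrArg Subtype.val h
    rcases lt_or_gt_of_ne hij with hl | hl
    · exact ⟨i, j, hl, h'⟩
    · exact ⟨j, i, hl, h'.symm⟩
  obtain ⟨i, j, hij, hBij⟩ := this
  have himg : ((g (A (Y j)) * (g (A (Y i)))⁻¹ : G ≃g G)) '' (F (Y i) : Set V) = ↑(F (Y j)) := by
    have h1 : ((g (A (Y j)) * (g (A (Y i)))⁻¹ : G ≃g G)) '' (F (Y i) : Set V) =
      (g (A (Y j))) '' (↑(B i) : Set V) := by
      rw [Finset.coe_image, ← Set.image_comp]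
      rfl
    rw [h1, hBij, Finset.coe_image, ← Set.image_comp]
    have : (⇑(g (A (Y j))) ∘ ⇑((g (A (Y j)))⁻¹ : G ≃g G)) = id := by
      funext x
      exact (g (A (Y j))).apply_symm_apply x
    rw [this, Set.image_id]
  have hsub : F (Y i) ⊆ Y j := by
    refine Finset.Subset.trans ?_ (hYm (show i + 1 ≤ j from hij))
    rw [hY]
    exact Finset.subset_union_right
  refine ⟨F (Y i), A (Y i), g (A (Y j)) * (g (A (Y i)))⁻¹, hF1 _, ?_, ?_⟩
  · intro s hs
    rw [himg]
    exact Finset.disjoint_left.mp (hF2 (Y j)) (hsub hs)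
  · intro s hs
    rw [himg]
    exact hF3 (Y j) s (hsub hs)

end Sep

/-! ### The contradiction -/

section Final

variable {V : Type} {G : SimpleGraph V} {r : ℕ → V}

theorem ray_of_walk (q : ℕ → V) (hq : ∀ n, G.Adj (q n) (q (n + 1)))
    (hfin : ∀ n, ∃ b, ∀ m, q m = q n → m ≤ b) :
    ∃ i : ℕ → ℕ, StrictMono i ∧ IsRay G (fun n => q (i n)) := by
  have h1 : ∀ n, ∃ l, q l = q n ∧ ∀ m, q m = q n → m ≤ l := by
    intro n
    obtain ⟨b, hb⟩ := hfin n
    classical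
    have hP : q n = q n := rfl
    have := Nat.findGreatest_spec (P := fun m => q m = q n) (hb n hP) hP
    exact ⟨Nat.findGreatest (fun m => q m = q n) b, this,
      fun m hm => Nat.le_findGreatest (hb m hm) hm⟩
  choose l hl1 hl2 using h1
  let i : ℕ → ℕ := fun n => Nat.rec (l 0) (fun _ j => l (j + 1)) n
  have hi : ∀ n, i (n + 1) = l (i n + 1) := fun n => rfl
  have hmono : StrictMono i := strictMono_nat_of_lt_succ fun n => by
    rw [hi]
    exact hl2 _ _ rfl
  have hlast : ∀ n m, q m = q (i n) → m ≤ i n := by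
    intro n m hm
    cases n with
    | zero => exact hl2 0 m (hm.trans (hl1 0))
    | succ n => exact hl2 _ m (hm.trans (hl1 _))
  refine ⟨i, hmono, ?_, ?_⟩
  · intro a b h
    have h' : q (i a) = q (i b) := h
    exact hmono.injective (le_antisymm (hlast b _ h') (hlast a _ h'.symm))
  · intro n
    show G.Adj (q (i n)) (q (i (n + 1)))
    rw [hi, hl1]
    exact hq _

theorem hits_finite (Z : ℤ → Set V) (hZ : ∀ m n, m ≠ n → Disjoint (Z m) (Z n)) (φ : ℕ → ℤ)
    (hφ : Function.Injective φ) (L : List V) (h : ∀ n, ∃ v ∈ L, v ∈ Z (φ n)) : False := by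
  classical
  choose c hc1 hc2 using h
  refine not_injective_infinite_finite
    (fun n => (⟨c n, by simpa using hc1 n⟩ : L.toFinset)) ?_
  intro a b hab
  have h' : c a = c b := congrArg Subtype.val hab
  by_contra hne
  exact Set.disjoint_left.mp (hZ _ _ (fun h => hne (hφ h))) (hc2 a) (h' ▸ hc2 b)

theorem no_translation (hone : OneEnded G) (hr : IsRay G r) {k : ℕ} (S : Finset V) (a : V)
    (h : G ≃g G) (hT : Tight G r k S a) (hdis : ∀ s ∈ S, s ∉ h '' (S : Set V))
    (hsep : ∀ s ∈ S, ¬ Side G r (h '' (S : Set V)) s) : False := by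
  let Z : ℤ → Set V := fun n => (h ^ n : G ≃g G) '' (S : Set V)
  have hZfin : ∀ n, (Z n).Finite := fun n => S.finite_toSet.image _
  have hZ0 : Z 0 = ↑S := by
    show (h ^ (0 : ℤ) : G ≃g G) '' (S : Set V) = _
    rw [zpow_zero]
    exact Set.image_id _
  have hZ1 : Z 1 = h '' (S : Set V) := by
    show (h ^ (1 : ℤ) : G ≃g G) '' (S : Set V) = _
    rw [zpow_one]
  have hZimg : ∀ m n, (h ^ m : G ≃g G) '' Z n = Z (m + n) := by
    intro m n
    show (h ^ m : G ≃g G) '' ((h ^ n : G ≃g G) '' (S : Set V)) = (h ^ (m + n) : G ≃g G) '' _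
    rw [← Set.image_comp, zpow_add]
    rfl
  have hshift : ∀ m n v, Side G r (Z (m + n)) ((h ^ m : G ≃g G) v) ↔ Side G r (Z n) v := by
    intro m n v
    rw [← hZimg]
    exact Side_map_iff hone hr _ (hZfin n)
  have hinv : ∀ (m : ℤ) v, (h ^ m : G ≃g G) ((h ^ (-m) : G ≃g G) v) = v := by
    intro m v
    have : ((h ^ m * h ^ (-m) : G ≃g G)) v = v := by
      rw [← zpow_add, add_neg_cancel, zpow_zero]
      rfl
    exact this
  have hshift' : ∀ m n v, Side G r (Z (m + n)) v ↔ Side G r (Z n) ((h ^ (-m) : G ≃g G) v) := by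
    intro m n v
    rw [← hshift m n, hinv]
  -- the basic facts
  have hA0 : ∀ v, Side G r (Z 1) v → Side G r (Z 0) v := by
    intro v hv
    rw [hZ0]
    rw [hZ1] at hv
    exact Side_anti subset_union_right (Side_avoid hv hsep)
  have hB0 : ∀ v ∈ Z 1, Side G r (Z 0) v := by
    intro v hv
    have hvS : v ∉ (Z 0) := by
      rw [hZ0]
      rw [hZ1] at hv
      exact fun h' => hdis v h' hv
    rw [hZ1] at hv
    obtain ⟨s, hs, rfl⟩ := hv
    obtain ⟨x, b, -, -, hb, hbS⟩ := hT.2.2.2.2 s hs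
    refine Side_step (h.map_adj_iff.mpr hb) hvS (hA0 _ ?_)
    rw [hZ1]
    exact Side_map hone hr h S.finite_toSet hbS
  have hA1 : ∀ n v, Side G r (Z (n + 1)) v → Side G r (Z n) v := by
    intro n v hv
    rw [hshift'] at hv
    have := hA0 _ hv
    rwa [← hshift', add_zero] at this
  have hB1 : ∀ n, ∀ v ∈ Z (n + 1), Side G r (Z n) v := by
    intro n v hv
    rw [← hZimg] at hv
    obtain ⟨w, hw, rfl⟩ := hv
    have := hB0 w hw
    rwa [← hshift n, add_zero] at this
  have hanti : ∀ m n, m ≤ n → ∀ v, Side G r (Z n) v → Side G r (Z m) v := by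
    intro m n hmn
    induction n, hmn using Int.le_induction with
    | base => exact fun v hv => hv
    | succ n hmn ih => exact fun v hv => ih v (hA1 n v hv)
  have hlt : ∀ m n, m < n → ∀ v ∈ Z n, Side G r (Z m) v := by
    intro m n hmn v hv
    refine hanti m (n - 1) (by omega) v (hB1 (n - 1) v ?_)
    rwa [sub_add_cancel]
  have hge : ∀ m n, m ≤ n → ∀ v ∈ Z m, ¬ Side G r (Z n) v :=
    fun m n hmn v hv hs => Side_notMem (hanti m n hmn v hs) hv
  have hZd : ∀ m n, m ≠ n → Disjoint (Z m) (Z n) := by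
    have aux : ∀ m n, m < n → Disjoint (Z m) (Z n) := by
      intro m n hmn
      rw [Set.disjoint_left]
      exact fun v hv hv' => Side_notMem (hlt m n hmn v hv') hv
    intro m n hmn
    rcases lt_or_gt_of_ne hmn with hl | hl
    · exact aux m n hl
    · exact (aux n m hl).symm
  obtain ⟨s, hs, -⟩ := hT.2.2.2.1
  have hs0 : Side G r ∅ s := by
    obtain ⟨x, b, -, -, hb, hbS⟩ := hT.2.2.2.2 s hs
    exact Side_step hb (by simp) (Side_anti (Set.empty_subset _) hbS)
  have hup : ∀ y, Side G r ∅ y → ∃ n : ℕ, ¬ Side G r (Z n) y := by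
    intro y hy
    by_contra hne
    push Not at hne
    obtain ⟨w, -⟩ := Side_RO hy hs0
    refine hits_finite Z hZd (fun n : ℕ => (n : ℤ)) Nat.cast_injective w.support fun n => ?_
    by_contra hno
    push Not at hno
    exact hge 0 n (by omega) s (by rw [hZ0]; exact hs)
      (Side_of_RO (RO_symm ⟨w, hno⟩) (hne n))
  have hdown : ∀ y, Side G r ∅ y → ∃ n : ℕ, Side G r (Z (-(n : ℤ))) y := by
    intro y hy
    by_contra hne
    push Not at hne
    obtain ⟨n0, hn0⟩ := Side_tail hr (hZfin 0)
    have hz := hn0 n0 le_rfl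
    obtain ⟨w, -⟩ := Side_RO hy (Side_anti (Set.empty_subset _) hz)
    refine hits_finite Z hZd (fun n : ℕ => -(n : ℤ))
      (fun a b hab => by simpa using hab) w.support fun n => ?_
    by_contra hno
    push Not at hno
    exact hne n (Side_of_RO ⟨w, hno⟩ (hanti _ _ (by omega) _ hz))
  have hmap0 : ∀ (g : G ≃g G) v, Side G r ∅ v → Side G r ∅ (g v) := by
    intro g v hv
    have := Side_map hone hr g Set.finite_empty hv
    rwa [Set.image_empty] at this
  -- the walk
  obtain ⟨p, -⟩ := Side_RO hs0 (hmap0 (h ^ (-1 : ℤ)) s hs0)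
  have hL : 0 < p.length := by
    rw [Nat.pos_iff_ne_zero]
    intro hlen
    have h1 : s = (h ^ (-1 : ℤ) : G ≃g G) s := p.eq_of_length_eq_zero hlen
    have h2 := hinv 1 s
    rw [← h1, zpow_one] at h2
    exact hdis s hs ⟨s, hs, h2⟩
  have hp0 : ∀ j, Side G r ∅ (p.getVert j) := fun j =>
    Side_of_RO (RO_of_mem p (by simp) (p.getVert_mem_support j))
      (hmap0 (h ^ (-1 : ℤ)) s hs0)
  choose M hM using fun j => hup _ (hp0 j)
  let N : ℕ := (Finset.range p.length).sup M
  have hN : ∀ j, j < p.length → ¬ Side G r (Z N) (p.getVert j) := by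
    intro j hj hs
    refine hM j (hanti _ _ ?_ _ hs)
    exact_mod_cast Finset.le_sup (f := M) (Finset.mem_range.mpr hj)
  let q : ℕ → V := fun m => (h ^ (-((m / p.length : ℕ) : ℤ)) : G ≃g G) (p.getVert (m % p.length))
  have hqN : ∀ m, ¬ Side G r (Z (-((m / p.length : ℕ) : ℤ) + N)) (q m) := by
    intro m
    show ¬ Side G r _ ((h ^ (-((m / p.length : ℕ) : ℤ)) : G ≃g G) _)
    rw [hshift]
    exact hN _ (Nat.mod_lt _ hL)
  have hqadj : ∀ m, G.Adj (q m) (q (m + 1)) := by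
    intro m
    have hmod := Nat.mod_lt m hL
    have hdm := Nat.div_add_mod m p.length
    have hadj := p.adj_getVert_succ hmod
    have h1 : G.Adj (q m) ((h ^ (-((m / p.length : ℕ) : ℤ)) : G ≃g G)
        (p.getVert (m % p.length + 1))) :=
      (h ^ (-((m / p.length : ℕ) : ℤ)) : G ≃g G).map_adj_iff.mpr hadj
    convert h1 using 1
    show (h ^ (-(((m + 1) / p.length : ℕ) : ℤ)) : G ≃g G) (p.getVert ((m + 1) % p.length)) = _
    by_cases hlast : m % p.length + 1 < p.length
    · have e1 : (m + 1) / p.length = m / p.length := by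
        rw [Nat.div_eq_iff hL, mul_comm (m / p.length)]
        constructor <;> omega
      have e2 : (m + 1) % p.length = m % p.length + 1 := by
        rw [Nat.add_mod, Nat.mod_eq_of_lt (a := 1) (by omega), Nat.mod_eq_of_lt hlast]
      rw [e1, e2]
    · have e0 : m % p.length + 1 = p.length := by omega
      have e3 : m + 1 = p.length * (m / p.length + 1) := by
        rw [mul_add, mul_one]; omega
      have e1 : (m + 1) / p.length = m / p.length + 1 := by
        rw [e3, Nat.mul_div_cancel_left _ hL]
      have e2 : (m + 1) % p.length = 0 := by
        rw [e3, Nat.mul_mod_right]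
      rw [e1, e2, e0, p.getVert_zero, p.getVert_length]
      have e4 : (-((m / p.length + 1 : ℕ) : ℤ)) = -((m / p.length : ℕ) : ℤ) + (-1) := by
        push_cast; ring
      rw [e4, zpow_add]
      rfl
  have hqfin : ∀ n, ∃ b, ∀ m, q m = q n → m ≤ b := by
    intro n
    obtain ⟨c, hc⟩ := hdown (q n) (hmap0 _ _ (hp0 _))
    refine ⟨(N + c) * p.length, fun m hm => ?_⟩
    by_contra hlt'
    push Not at hlt'
    have h1 : N + c ≤ m / p.length := by
      rw [Nat.le_div_iff_mul_le hL]
      exact hlt'.le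
    refine hqN m (hanti _ (-(c : ℤ)) ?_ _ (hm ▸ hc))
    omega
  obtain ⟨i, hi, hray⟩ := ray_of_walk q hqadj hqfin
  obtain ⟨m, n, hm, hn, hmn⟩ := hone.2 _ _ hray hr (Z 0) (hZfin 0)
  have h1 : Side G r (Z 0) (q (i (m + N * p.length))) := by
    have h2 : Side G r (Z 0) (q (i m)) := Side_of_RO_tail hr hn hmn
    exact Side_of_RO (RO_symm (RO_tail hray.2 hm _ (by omega))) h2
  refine hqN _ (hanti _ 0 ?_ _ h1)
  have h3 : N ≤ i (m + N * p.length) / p.length := by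
    rw [Nat.le_div_iff_mul_le hL]
    have := hi.le_apply (x := m + N * p.length)
    omega
  omega

theorem undom_case (hone : OneEnded G) (hr : IsRay G r) (hu : Undom G r)
    (hqt : ∃ s : Finset V, ∀ v : V, ∃ u ∈ s, ∃ φ : G ≃g G, φ u = v) (k : ℕ) :
    ∃ f : Fin (k + 1) → ℕ → V, (∀ i, IsRay G (f i)) ∧ DisjointRays f := by
  by_contra hk
  obtain ⟨S, a, h, h1, h2, h3⟩ := exists_translation hone hr hu hqt k hk
  exact no_translation hone hr S a h h1 h2 h3

/-- Delete all edges meeting `D`. -/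
def isolate (G : SimpleGraph V) (D : Set V) : SimpleGraph V where
  Adj a b := G.Adj a b ∧ a ∉ D ∧ b ∉ D
  symm := ⟨fun _ _ h => ⟨h.1.symm, h.2.2, h.2.1⟩⟩
  loopless := ⟨fun _ h => G.loopless.irrefl _ h.1⟩

theorem isolate_le (D : Set V) : isolate G D ≤ G := fun _ _ h => h.1

theorem isRay_of_isolate {D : Set V} (h : IsRay (isolate G D) r) : IsRay G r :=
  ⟨h.1, fun n => (h.2 n).1⟩

theorem RO_isolate {D S : Set V} {a b : V} (h : ReachableOutside G (S ∪ D) a b) :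
    ReachableOutside (isolate G D) S a b := by
  obtain ⟨w, hw⟩ := h
  induction w with
  | nil =>
    rename_i u
    exact RO_refl fun h => hw u (by simp) (Or.inl h)
  | cons hadj p ih =>
    rename_i u v w
    refine RO_step (G := isolate G D) ⟨hadj, ?_, ?_⟩ ?_ (ih fun x hx => hw x (by simp [hx]))
    · exact fun h => hw u (by simp) (Or.inr h)
    · exact fun h => hw v (by simp) (Or.inr h)
    · exact fun h => hw u (by simp) (Or.inl h)

theorem RO_of_isolate {D S : Set V} {a b : V} (ha : a ∉ D)
    (h : ReachableOutside (isolate G D) S a b) : ReachableOutside G (S ∪ D) a b := by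
  obtain ⟨w, hw⟩ := h
  induction w with
  | nil =>
    rename_i u
    exact RO_refl fun h => h.elim (hw u (by simp)) ha
  | cons hadj p ih =>
    rename_i u v w
    refine RO_step hadj.1 ?_ (ih hadj.2.2 fun x hx => hw x (by simp [hx]))
    exact fun h => h.elim (hw u (by simp)) ha

end Final

/-- the unique end of a one-ended quasi-transitive graph is thick,
i.e. has infinite vertex degree (no natural number is its vertex degree). -/
theorem quasi_transitive_one_ended_thick {V : Type} (G : SimpleGraph V)
    (hqt : ∃ s : Finset V, ∀ v : V, ∃ u ∈ s, ∃ φ : G ≃g G, φ u = v)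
    (hone : OneEnded G) (ω : ℕ → V) (hω : IsRay G ω) :
    ¬ ∃ k : ℕ, EndVertexDegree G ω k := by
  rintro ⟨k, -, hk⟩
  apply hk
  classical
  suffices h : ∃ f : Fin (k + 1) → ℕ → V, (∀ i, IsRay G (f i)) ∧ DisjointRays f by
    obtain ⟨f, hf, hd⟩ := h
    exact ⟨f, fun i => ⟨hf i, hone.2 _ _ (hf i) hω⟩, hd⟩
  set D : Set V := {v | ∀ S : Finset V, v ∉ S → Side G ω S v} with hD
  by_cases hinf : D.Infinite
  · exact rays_dom (k + 1) hinf
  rw [Set.not_infinite] at hinf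
  obtain ⟨n0, hn0⟩ := ray_avoid hω hinf
  have hray : IsRay (isolate G D) (fun n => ω (n + n0)) := by
    refine ⟨fun a b h => ?_, fun n => ⟨?_, hn0 _ (by omega), hn0 _ (by omega)⟩⟩
    · have := hω.1 h
      omega
    · have := hω.2 (n + n0)
      rwa [show n + n0 + 1 = n + 1 + n0 by omega] at this
  have hone' : OneEnded (isolate G D) := by
    refine ⟨⟨_, hray⟩, fun r₁ r₂ h1 h2 S hS => ?_⟩
    obtain ⟨m, n, hm, hn, hmn⟩ := hone.2 r₁ r₂ (isRay_of_isolate h1) (isRay_of_isolate h2)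
      (S ∪ D) (hS.union hinf)
    exact ⟨m, n, fun i hi h => hm i hi (Or.inl h), fun i hi h => hn i hi (Or.inl h),
      RO_isolate hmn⟩
  have hDmap : ∀ (g : G ≃g G) v, v ∈ D → g v ∈ D := by
    intro g v hv S hS
    have h1 : v ∉ S.image (g⁻¹ : G ≃g G) := by
      rw [Finset.mem_image]
      rintro ⟨x, hx, rfl⟩
      have : g ((g⁻¹ : G ≃g G) x) = x := g.apply_symm_apply x
      rw [this] at hS
      exact hS hx
    have h2 := Side_map hone hω g (Finset.finite_toSet _) (hv _ h1)
    rw [Finset.coe_image, ← Set.image_comp] at h2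
    have h3 : (⇑g ∘ ⇑(g⁻¹ : G ≃g G)) = id := by
      funext x
      exact g.apply_symm_apply x
    rwa [h3, Set.image_id] at h2
  have hDiff : ∀ (g : G ≃g G) v, g v ∈ D ↔ v ∈ D := by
    intro g v
    refine ⟨fun h => ?_, hDmap g v⟩
    have h1 := hDmap (g⁻¹ : G ≃g G) _ h
    have h2 : (g⁻¹ : G ≃g G) (g v) = v := g.symm_apply_apply v
    rwa [h2] at h1
  have hqt' : ∃ s : Finset V, ∀ v : V, ∃ u ∈ s,
      ∃ φ : (isolate G D) ≃g (isolate G D), φ u = v := by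
    obtain ⟨s, hs⟩ := hqt
    refine ⟨s, fun v => ?_⟩
    obtain ⟨u, hu, g, hg⟩ := hs v
    refine ⟨u, hu, ⟨g.toEquiv, ?_⟩, hg⟩
    intro a b
    show (G.Adj (g a) (g b) ∧ g a ∉ D ∧ g b ∉ D) ↔ (G.Adj a b ∧ a ∉ D ∧ b ∉ D)
    rw [hDiff, hDiff, g.map_adj_iff]
  have hund : Undom (isolate G D) (fun n => ω (n + n0)) := by
    intro v
    by_cases hv : v ∈ D
    · refine ⟨∅, by simp, ?_⟩
      rintro ⟨n, hn⟩
      obtain ⟨w, -⟩ := hn n le_rfl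
      have hne : v ≠ ω (n + n0) := by
        rintro rfl
        exact hn0 _ (by omega) hv
      cases w with
      | nil => exact hne rfl
      | cons hadj p => exact hadj.2.1 hv
    · have hv' := hv
      rw [hD, Set.mem_setOf_eq] at hv'
      push Not at hv'
      obtain ⟨S, hvS, hS⟩ := hv'
      refine ⟨S, hvS, ?_⟩
      rintro ⟨n, hn⟩
      refine hS ⟨n + n0, fun m hm => ?_⟩
      have h1 := hn (m - n0) (by omega)
      dsimp only at h1
      rw [show m - n0 + n0 = m by omega] at h1
      exact RO_mono subset_union_left (RO_of_isolate hv h1)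
  obtain ⟨f, hf, hd⟩ := undom_case hone' hray hund hqt' k
  exact ⟨f, fun i => isRay_of_isolate (hf i), hd⟩

end PaperEnds
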